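/- With the notation below, the sequence (2n/(n−1))·Vol(Tₙ) converges as n → ∞ to 5·v_tet, where v_tet = −2∫₀^{π/6} log(2 sin t) dt ≈ 1.0149416 is the volume of the regular ideal hyperbolic tetrahedron. (This is the limit claim in the proof of the upper volume bound for hyperbolic n-bongles: as n approaches ∞, the left-hand side of the desired inequality approaches 5 v_tet ≈ 5.0747….) -/

import Mathlib

open Real Filter

/-- The dilogarithm `Li₂(z) = −∫₀¹ log(1−tz)/t dt`, with the principal branch of the
complex logarithm, the integrand extended continuously by the value `−z` at `t = 0`. -/
noncomputable def Li2 (z : ℂ) : ℂ :=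
  -∫ t in (0:ℝ)..1, if t = 0 then -z else Complex.log (1 - (t : ℂ) * z) / (t : ℂ)

/-- `θₙ = 2π/(3n)`. -/
noncomputable def theta (n : ℕ) : ℝ := 2 * Real.pi / (3 * n)

/-- `z₁(n) = 1 + i·tan θₙ`. -/
noncomputable def z1 (n : ℕ) : ℂ := 1 + Complex.I * (Real.tan (theta n) : ℂ)

/-- `z₂(n) = −1 + i·tan θₙ`. -/
noncomputable def z2 (n : ℕ) : ℂ := -1 + Complex.I * (Real.tan (theta n) : ℂ)

/-- Ushijima's term `U(z, Tₙ)`. -/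
noncomputable def U (n : ℕ) (z : ℂ) : ℂ :=
  (3/2) * (Li2 (Complex.exp (2 * (Real.pi : ℂ) * Complex.I / 3)
                  * Complex.exp (2 * Complex.I * (theta n : ℂ)) * z)
          - Li2 (-Complex.exp ((Real.pi : ℂ) * Complex.I / 3)
                  * Complex.exp (2 * Complex.I * (theta n : ℂ)) * z))

/-- `Vol(Tₙ) = (1/2)·Im(U(z₁,Tₙ) − U(z₂,Tₙ))`, the volume of the hyperbolic tetrahedron
with one ideal vertex and three truncated vertices, dihedral angle `π/3` on the edges into
the ideal vertex and `2π/(3n)` on the edges joining the truncated vertices. -/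
noncomputable def volT (n : ℕ) : ℝ := (1/2) * (U n (z1 n) - U n (z2 n)).im

/-- `v_tet = −2∫₀^{π/6} log(2 sin t) dt`, the volume of the regular ideal hyperbolic
tetrahedron. -/
noncomputable def vTet : ℝ :=
  -2 * ∫ t in (0:ℝ)..(Real.pi / 6), Real.log (2 * Real.sin t)

open MeasureTheory Set Topology

/-- The holomorphic extension of `log (1 - z) / z`. -/
noncomputable def qfun (z : ℂ) : ℂ := dslope (fun z : ℂ => Complex.log (1 - z)) 0 z

/-- The cut plane `ℂ \ [1, ∞)`. -/
def Scut : Set ℂ := {z | 1 - z ∈ Complex.slitPlane}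

lemma isOpen_Scut : IsOpen Scut :=
  Complex.isOpen_slitPlane.preimage (by fun_prop)

lemma zero_mem_Scut : (0 : ℂ) ∈ Scut := by simp [Scut]

lemma ball_subset_Scut : Metric.ball (0:ℂ) 1 ⊆ Scut := by
  intro z hz
  have hz : ‖z‖ < 1 := by simpa using hz
  left
  have := Complex.re_le_norm z
  simp only [Complex.sub_re, Complex.one_re]; linarith

lemma mem_Scut_of_im {z : ℂ} (hz : z.im ≠ 0) : z ∈ Scut := by
  right; simpa using hz

lemma smul_mem_Scut {z : ℂ} (hz : z ∈ Scut) {t : ℝ} (h0 : 0 ≤ t) (h1 : t ≤ 1) :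
    (t : ℂ) * z ∈ Scut := by
  rcases hz with h | h
  · left
    simp at h ⊢
    rcases le_or_gt z.re 0 with hz | hz <;> nlinarith
  · rcases eq_or_lt_of_le h0 with rfl | h0
    · simpa using zero_mem_Scut
    · right
      simp at h ⊢
      exact ⟨h0.ne', h⟩

lemma qfun_of_ne {z : ℂ} (hz : z ≠ 0) : qfun z = Complex.log (1 - z) / z := by
  rw [qfun, dslope_of_ne _ hz, slope_def_field]; simp

lemma mul_qfun (z : ℂ) : z * qfun z = Complex.log (1 - z) := by
  rcases eq_or_ne z 0 with rfl | hz
  · simp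
  · rw [qfun_of_ne hz]; field_simp

lemma qfun_diff : DifferentiableOn ℂ qfun Scut := by
  refine (Complex.differentiableOn_dslope (isOpen_Scut.mem_nhds zero_mem_Scut)).2 ?_
  intro z hz
  have h : (1 - z) ∈ Complex.slitPlane := hz
  exact ((DifferentiableAt.clog (by fun_prop) h)).differentiableWithinAt

lemma Li2_eq (z : ℂ) : Li2 z = -∫ t in (0:ℝ)..1, z * qfun ((t:ℂ) * z) := by
  rw [Li2]
  congr 1
  apply intervalIntegral.integral_congr_ae
  filter_upwards [(measure_singleton (0:ℝ) : volume {(0:ℝ)} = 0) |> compl_mem_ae_iff.2] with t ht _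
  have ht : t ≠ 0 := by simpa using ht
  rw [if_neg ht]
  rcases eq_or_ne z 0 with rfl | hz
  · simp
  have htc : (t:ℂ) ≠ 0 := by exact_mod_cast ht
  rw [qfun_of_ne (mul_ne_zero htc hz)]
  field_simp

lemma Li2_continuousAt {w : ℂ} (hw : w ∈ Scut) : ContinuousAt Li2 w := by
  have e : Li2 = fun z => -∫ t in (0:ℝ)..1, z * qfun ((t:ℂ) * z) := funext Li2_eq
  rw [e]
  apply ContinuousAt.neg
  obtain ⟨ε, hε, hb⟩ := Metric.nhds_basis_closedBall.mem_iff.1 (isOpen_Scut.mem_nhds hw)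
  have hq := qfun_diff.continuousOn
  have hc : ContinuousOn (fun p : ℝ × ℂ => p.2 * qfun ((p.1:ℂ) * p.2))
      (Icc (0:ℝ) 1 ×ˢ Metric.closedBall w ε) := by
    apply ContinuousOn.mul (by fun_prop)
    refine hq.comp (by fun_prop) ?_
    rintro ⟨t, z⟩ ⟨ht, hz⟩
    exact smul_mem_Scut (hb hz) ht.1 ht.2
  obtain ⟨C, hC⟩ := (isCompact_Icc.prod (isCompact_closedBall w ε)).exists_bound_of_continuousOn hc
  have hnb : ∀ᶠ z in 𝓝 w, z ∈ Metric.closedBall w ε := Metric.closedBall_mem_nhds w hε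
  apply intervalIntegral.continuousAt_of_dominated_interval (bound := fun _ => C)
  · filter_upwards [hnb] with z hz
    rw [uIoc_of_le zero_le_one]
    apply ContinuousOn.aestronglyMeasurable _ measurableSet_Ioc
    exact hc.comp (f := fun t : ℝ => (t, z)) (by fun_prop) (fun t ht => ⟨Ioc_subset_Icc_self ht, hz⟩)
  · filter_upwards [hnb] with z hz
    refine Eventually.of_forall fun t ht => ?_
    rw [uIoc_of_le zero_le_one] at ht
    exact hC (t, z) ⟨Ioc_subset_Icc_self ht, hz⟩
  · exact intervalIntegrable_const
  · refine Eventually.of_forall fun t ht => ?_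
    rw [uIoc_of_le zero_le_one] at ht
    apply ContinuousAt.mul continuousAt_id
    have := hq.continuousAt (isOpen_Scut.mem_nhds (smul_mem_Scut hw ht.1.le ht.2))
    exact ContinuousAt.comp (f := fun z : ℂ => (t:ℂ) * z) (g := qfun) this (by fun_prop)

lemma Li2_hasDerivAt {w : ℂ} (hw : ‖w‖ < 1) : HasDerivAt Li2 (-qfun w) w := by
  obtain ⟨F, hF⟩ := (qfun_diff.mono ball_subset_Scut).isExactOn_ball
  have key : ∀ z ∈ Metric.ball (0:ℂ) 1, Li2 z = -(F z - F 0) := by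
    intro z hz
    have hin : ∀ t ∈ uIcc (0:ℝ) 1, (t:ℂ) * z ∈ Metric.ball (0:ℂ) 1 := by
      intro t ht
      rw [uIcc_of_le zero_le_one] at ht
      simp only [Metric.mem_ball, dist_zero_right, norm_mul, Complex.norm_real, norm_eq_abs,
        abs_of_nonneg ht.1] at hz ⊢
      nlinarith [ht.1, ht.2, norm_nonneg z]
    rw [Li2_eq, intervalIntegral.integral_eq_sub_of_hasDerivAt (f := fun t : ℝ => F ((t:ℂ) * z))]
    · simp
    · intro t ht
      have h1 : HasDerivAt (fun t : ℝ => (t:ℂ) * z) z t := by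
        simpa using (Complex.ofRealCLM.hasDerivAt (x := t)).mul_const z
      have := (hF _ (hin t ht)).comp t h1
      rw [mul_comm]; exact this
    · apply ContinuousOn.intervalIntegrable
      apply ContinuousOn.mul (by fun_prop)
      exact (qfun_diff.mono ball_subset_Scut).continuousOn.comp (by fun_prop) hin
  have hb : w ∈ Metric.ball (0:ℂ) 1 := by simpa using hw
  refine HasDerivAt.congr_of_eventuallyEq ((hF w hb).sub_const (F 0)).neg ?_
  filter_upwards [Metric.isOpen_ball.mem_nhds hb] with z hz using key z hz

lemma Li2_conj {z : ℂ} (hz : z ∈ Scut) :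
    Li2 ((starRingEnd ℂ) z) = (starRingEnd ℂ) (Li2 z) := by
  rw [Li2, Li2, map_neg, ← intervalIntegral.intervalIntegral_conj]
  congr 1
  apply intervalIntegral.integral_congr
  intro t ht
  rw [uIcc_of_le zero_le_one] at ht
  by_cases h : t = 0
  · simp [h]
  · have := Complex.log_conj (1 - t * z)
      (Complex.slitPlane_arg_ne_pi (smul_mem_Scut hz ht.1 ht.2))
    simp only [h, if_false, map_div₀, Complex.conj_ofReal, ← this, map_sub, map_one, map_mul]

lemma log_dup {z : ℂ} (hz : ‖z‖ < 1) :
    Complex.log (1 - z ^ 2) = Complex.log (1 - z) + Complex.log (1 - -z) := by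
  have a1 := Complex.re_le_norm z
  have a2 := Complex.re_le_norm (-z)
  rw [norm_neg, Complex.neg_re] at a2
  have h1 : 0 < (1 - z).re := by simp; linarith
  have h2 : 0 < (1 - -z).re := by
    rw [Complex.sub_re, Complex.neg_re, Complex.one_re]; linarith
  have b1 := abs_lt.1 (Complex.abs_arg_lt_pi_div_two_iff.2 (Or.inl h1))
  have b2 := abs_lt.1 (Complex.abs_arg_lt_pi_div_two_iff.2 (Or.inl h2))
  rw [← Complex.log_mul]
  · ring_nf
  · rintro h; rw [h] at h1; simp at h1
  · rintro h; rw [h] at h2; simp at h2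
  · constructor <;> linarith [b1.1, b1.2, b2.1, b2.2]

lemma Li2_zero : Li2 0 = 0 := by rw [Li2_eq]; simp

lemma Li2_dup_ball {z : ℂ} (hz : ‖z‖ < 1) :
    Li2 (z ^ 2) - 2 * Li2 z - 2 * Li2 (-z) = 0 := by
  have hd : ∀ z ∈ Metric.ball (0:ℂ) 1,
      HasDerivAt (fun z => Li2 (z ^ 2) - 2 * Li2 z - 2 * Li2 (-z)) 0 z := by
    intro z hz
    have hz : ‖z‖ < 1 := by simpa using hz
    have h2 : ‖z ^ 2‖ < 1 := by
      rw [norm_pow]; nlinarith [norm_nonneg z]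
    have d1 := (Li2_hasDerivAt h2).comp z (hasDerivAt_pow 2 z)
    have d2 := (Li2_hasDerivAt hz).const_mul 2
    have d3 := ((Li2_hasDerivAt (w := -z) (by simpa using hz)).comp z
      (hasDerivAt_neg z)).const_mul 2
    have := (d1.sub d2).sub d3
    refine HasDerivAt.congr_deriv this ?_
    rcases eq_or_ne z 0 with rfl | h0
    · simp
    · rw [qfun_of_ne h0, qfun_of_ne (neg_ne_zero.2 h0), qfun_of_ne (pow_ne_zero 2 h0), log_dup hz]
      field_simp
      ring
  have := Metric.isOpen_ball.is_const_of_deriv_eq_zero (convex_ball (0:ℂ) 1).isPreconnected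
    (fun z hz => (hd z hz).differentiableAt.differentiableWithinAt)
    (fun z hz => (hd z hz).deriv) (x := z) (y := 0) (by simpa using hz) (by simp)
  simpa [Li2_zero] using this

lemma tendsto_radial (a : ℂ) : Tendsto (fun r : ℝ => (r : ℂ) * a) (𝓝[<] 1) (𝓝 a) := by
  have : ContinuousAt (fun r : ℝ => (r : ℂ) * a) 1 := by fun_prop
  have h := this.tendsto
  simp only [Complex.ofReal_one, one_mul] at h
  exact h.mono_left nhdsWithin_le_nhds

lemma ev_r : ∀ᶠ r : ℝ in 𝓝[<] 1, 0 < r ∧ r < 1 :=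
  Ioo_mem_nhdsLT zero_lt_one

lemma Li2_dup {a : ℂ} (ha : ‖a‖ = 1) (h1 : a ∈ Scut) (h2 : -a ∈ Scut) (h3 : a ^ 2 ∈ Scut) :
    Li2 (a ^ 2) - 2 * Li2 a - 2 * Li2 (-a) = 0 := by
  have hr := tendsto_radial a
  have t1 := (Li2_continuousAt h1).tendsto.comp hr
  have t2 := (Li2_continuousAt h2).tendsto.comp hr.neg
  have t3 := (Li2_continuousAt h3).tendsto.comp (hr.pow 2)
  have t := (t3.sub (t1.const_mul 2)).sub (t2.const_mul 2)
  refine tendsto_nhds_unique t (tendsto_const_nhds.congr' ?_)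
  filter_upwards [ev_r] with r hr
  exact (Li2_dup_ball (z := (r:ℂ) * a) (by simp [ha, abs_of_pos hr.1, hr.2])).symm

lemma norm_sq_one_sub (r s : ℝ) :
    ‖1 - (r:ℂ) * Complex.exp (s * Complex.I)‖ ^ 2 = sin s ^ 2 + (r - cos s) ^ 2 := by
  rw [← Complex.normSq_eq_norm_sq, Complex.normSq_apply]
  simp [Complex.exp_ofReal_mul_I_re, Complex.exp_ofReal_mul_I_im]
  linear_combination (r ^ 2 - 1) * sin_sq_add_cos_sq s

lemma Li2_radial {r φ : ℝ} (h0 : 0 < r) (h1 : r < 1) :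
    (Li2 ((r:ℂ) * Complex.exp (φ * Complex.I))).im
      = ∫ s in (0:ℝ)..φ, -Real.log ‖1 - (r:ℂ) * Complex.exp (s * Complex.I)‖ := by
  have hn : ∀ s : ℝ, ‖(r:ℂ) * Complex.exp (s * Complex.I)‖ < 1 := by
    intro s; simp [Complex.norm_exp_ofReal_mul_I, abs_of_pos h0, h1]
  rw [intervalIntegral.integral_eq_sub_of_hasDerivAt
    (f := fun s : ℝ => (Li2 ((r:ℂ) * Complex.exp (s * Complex.I))).im)]
  · have : (Li2 (r:ℂ)).im = 0 := by
      apply Complex.conj_eq_iff_im.1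
      rw [← Li2_conj, Complex.conj_ofReal]
      apply ball_subset_Scut
      simp [abs_of_pos h0, h1]
    simp [this]
  · intro s _
    have d1 : HasDerivAt (fun s : ℝ => (r:ℂ) * Complex.exp (s * Complex.I))
        ((r:ℂ) * (Complex.exp (s * Complex.I) * Complex.I)) s := by
      apply HasDerivAt.const_mul
      have := (((Complex.ofRealCLM.hasDerivAt (x := s)).mul_const Complex.I)).cexp
      simpa using this
    have d2 := (Li2_hasDerivAt (hn s)).comp s d1
    have d3 := (Complex.imCLM.hasFDerivAt).comp_hasDerivAt s d2
    refine HasDerivAt.congr_deriv d3 ?_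
    rw [← Complex.log_re, ← mul_qfun]
    simp only [Complex.imCLM_apply]
    rw [show -qfun (r * Complex.exp (s * Complex.I)) * (r * (Complex.exp (s * Complex.I) * Complex.I))
      = -((r * Complex.exp (s * Complex.I)) * qfun (r * Complex.exp (s * Complex.I)) * Complex.I) by ring]
    rw [Complex.neg_im, Complex.mul_I_im]
  · apply Continuous.intervalIntegrable
    apply Continuous.neg
    apply Continuous.log (by fun_prop)
    intro s h
    rw [norm_eq_zero, sub_eq_zero] at h
    have := hn s
    rw [← h] at this
    simp at this

lemma Li2_im_pi_div_three : (Li2 (Complex.exp ((π / 3 : ℝ) * Complex.I))).im = vTet := by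
  have hpi := Real.pi_pos
  have hs : Complex.exp ((π / 3 : ℝ) * Complex.I) ∈ Scut := by
    apply mem_Scut_of_im
    rw [Complex.exp_ofReal_mul_I_im, Real.sin_pi_div_three]
    positivity
  have t1 := (Complex.continuous_im.tendsto _).comp ((Li2_continuousAt hs).tendsto.comp (tendsto_radial _))
  have t2 : Tendsto (fun r : ℝ => ∫ s in (0:ℝ)..(π/3),
      -Real.log ‖1 - (r:ℂ) * Complex.exp (s * Complex.I)‖) (𝓝[<] 1)
      (𝓝 (∫ s in (0:ℝ)..(π/3), -Real.log (2 * sin (s / 2)))) := by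
    apply intervalIntegral.tendsto_integral_filter_of_dominated_convergence
      (fun s => Real.log 2 + |Real.log (sin s)|)
    · refine Eventually.of_forall fun r => ?_
      apply Measurable.aestronglyMeasurable
      fun_prop
    · filter_upwards [ev_r] with r hr
      refine Eventually.of_forall fun s hs => ?_
      rw [uIoc_of_le (by positivity)] at hs
      have hsin : 0 < sin s := sin_pos_of_pos_of_lt_pi hs.1 (by linarith [hs.2])
      have hsq := norm_sq_one_sub r s
      have l1 : sin s ≤ ‖1 - (r:ℂ) * Complex.exp (s * Complex.I)‖ := by
        apply le_of_sq_le_sq _ (norm_nonneg _)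
        nlinarith [sq_nonneg (r - cos s)]
      have l2 : ‖1 - (r:ℂ) * Complex.exp (s * Complex.I)‖ ≤ 2 := by
        refine (norm_sub_le _ _).trans ?_
        simp [Complex.norm_exp_ofReal_mul_I, abs_of_pos hr.1]
        linarith [hr.2]
      have m1 := Real.log_le_log hsin l1
      have m2 := Real.log_le_log (hsin.trans_le l1) l2
      have m3 := neg_abs_le (Real.log (sin s))
      have m4 := abs_nonneg (Real.log (sin s))
      have m5 := Real.log_nonneg (one_le_two)
      rw [norm_neg, Real.norm_eq_abs, abs_le]
      constructor <;> linarith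
    · exact intervalIntegrable_const.add (intervalIntegrable_log_sin (a := 0) (b := π/3)).abs
    · refine Eventually.of_forall fun s hs => ?_
      rw [uIoc_of_le (by positivity)] at hs
      have hsin : 0 < sin (s/2) := sin_pos_of_pos_of_lt_pi (by linarith [hs.1]) (by linarith [hs.2])
      have e : ‖1 - Complex.exp (s * Complex.I)‖ = 2 * sin (s/2) := by
        rw [norm_sub_rev, mul_comm, Complex.norm_exp_I_mul_ofReal_sub_one, Real.norm_eq_abs,
          abs_of_pos (by positivity)]
      rw [← e]
      apply Tendsto.neg
      apply Tendsto.log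
      · exact (tendsto_const_nhds.sub (tendsto_radial _)).norm
      · rw [e]; positivity
  have := tendsto_nhds_unique (t1.congr' ?_) t2
  · rw [this, vTet, intervalIntegral.integral_neg,
      intervalIntegral.integral_comp_div (fun u => Real.log (2 * sin u)) two_ne_zero]
    rw [zero_div, show π / 3 / 2 = π / 6 by ring]
    simp
  · filter_upwards [ev_r] with r hr
    exact Li2_radial hr.1 hr.2

lemma exp_sq_eq : Complex.exp ((π / 3 : ℝ) * Complex.I) ^ 2
    = Complex.exp ((2 * π / 3 : ℝ) * Complex.I) := by
  rw [← Complex.exp_nat_mul]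
  congr 1
  push_cast; ring

lemma sin_two_pi_div_three' : sin (2 * π / 3) = √3 / 2 := by
  rw [← Real.sin_pi_div_three, ← Real.sin_pi_sub]
  congr 1; ring

lemma cos_two_pi_div_three' : cos (2 * π / 3) = -(1 / 2) := by
  rw [← Real.cos_pi_div_three, ← Real.cos_pi_sub]
  congr 1; ring

lemma neg_exp_eq : -Complex.exp ((π / 3 : ℝ) * Complex.I)
    = (starRingEnd ℂ) (Complex.exp ((2 * π / 3 : ℝ) * Complex.I)) := by
  apply Complex.ext
  · rw [Complex.conj_re, Complex.neg_re, Complex.exp_ofReal_mul_I_re, Complex.exp_ofReal_mul_I_re,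
      cos_two_pi_div_three', Real.cos_pi_div_three]
  · rw [Complex.conj_im, Complex.neg_im, Complex.exp_ofReal_mul_I_im, Complex.exp_ofReal_mul_I_im,
      sin_two_pi_div_three', Real.sin_pi_div_three]

lemma exp1_im : (Complex.exp ((π / 3 : ℝ) * Complex.I)).im ≠ 0 := by
  rw [Complex.exp_ofReal_mul_I_im, Real.sin_pi_div_three]
  positivity

lemma exp2_im : (Complex.exp ((2 * π / 3 : ℝ) * Complex.I)).im ≠ 0 := by
  rw [Complex.exp_ofReal_mul_I_im, sin_two_pi_div_three']
  positivity

lemma Li2_im_two_pi_div_three :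
    (Li2 (Complex.exp ((2 * π / 3 : ℝ) * Complex.I))).im = 2 / 3 * vTet := by
  have h := Li2_dup (a := Complex.exp ((π / 3 : ℝ) * Complex.I))
    (Complex.norm_exp_ofReal_mul_I _) (mem_Scut_of_im exp1_im)
    (mem_Scut_of_im (by simpa using exp1_im)) (mem_Scut_of_im (by rw [exp_sq_eq]; exact exp2_im))
  rw [exp_sq_eq, neg_exp_eq, Li2_conj (mem_Scut_of_im exp2_im)] at h
  have h' := congrArg Complex.im h
  have h3 := Li2_im_pi_div_three
  simp only [Complex.sub_im, Complex.mul_im, Complex.conj_im, Complex.zero_im, Complex.re_ofNat,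
    Complex.im_ofNat, zero_mul, add_zero] at h'
  linarith

lemma tendsto_theta : Tendsto theta atTop (𝓝 0) := by
  have h : Tendsto (fun n : ℕ => (2 * π / 3) / (n:ℝ)) atTop (𝓝 0) :=
    tendsto_const_div_atTop_nhds_zero_nat _
  refine h.congr fun n => ?_
  rw [theta, div_div]

lemma tendsto_U {z : ℕ → ℂ} {c : ℂ} (hz : Tendsto z atTop (𝓝 c))
    (h1 : Complex.exp ((2 * π / 3 : ℝ) * Complex.I) * c ∈ Scut)
    (h2 : -Complex.exp ((π / 3 : ℝ) * Complex.I) * c ∈ Scut) :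
    Tendsto (fun n => U n (z n)) atTop
      (𝓝 ((3/2) * (Li2 (Complex.exp ((2 * π / 3 : ℝ) * Complex.I) * c)
        - Li2 (-Complex.exp ((π / 3 : ℝ) * Complex.I) * c)))) := by
  have ht : Tendsto (fun n => Complex.exp (2 * Complex.I * (theta n : ℂ))) atTop (𝓝 1) := by
    have hc : Continuous (fun x : ℝ => Complex.exp (2 * Complex.I * (x : ℂ))) := by fun_prop
    have := (hc.tendsto 0).comp tendsto_theta
    simpa [Function.comp_def] using this
  have e1 : Complex.exp (2 * (π : ℂ) * Complex.I / 3)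
      = Complex.exp ((2 * π / 3 : ℝ) * Complex.I) := by
    congr 1; push_cast; ring
  have e2 : Complex.exp ((π : ℂ) * Complex.I / 3)
      = Complex.exp ((π / 3 : ℝ) * Complex.I) := by
    congr 1; push_cast; ring
  have aux : ∀ b : ℂ, Tendsto (fun n => b * Complex.exp (2 * Complex.I * (theta n : ℂ)) * z n)
      atTop (𝓝 (b * c)) := by
    intro b
    have := (ht.const_mul b).mul hz
    simpa using this
  unfold U
  rw [e1, e2]
  exact (((Li2_continuousAt h1).tendsto.comp (aux _)).sub
    ((Li2_continuousAt h2).tendsto.comp (aux _))).const_mul _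

lemma tendsto_tan : Tendsto (fun n => Complex.I * (Real.tan (theta n) : ℂ)) atTop (𝓝 0) := by
  have hc : ContinuousAt Real.tan 0 := Real.continuousAt_tan.2 (by simp)
  have h := hc.tendsto.comp tendsto_theta
  rw [Real.tan_zero] at h
  have := ((Complex.continuous_ofReal.tendsto 0).comp h).const_mul Complex.I
  simpa [Function.comp_def] using this

lemma tendsto_volT : Tendsto volT atTop (𝓝 (5 / 2 * vTet)) := by
  have c1 : Tendsto z1 atTop (𝓝 1) := by
    have := (tendsto_const_nhds (x := (1:ℂ))).add tendsto_tan
    rwa [add_zero] at this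
  have c2 : Tendsto z2 atTop (𝓝 (-1)) := by
    have := (tendsto_const_nhds (x := (-1:ℂ))).add tendsto_tan
    rwa [add_zero] at this
  have s1 := exp1_im
  have s2 := exp2_im
  have u1 := tendsto_U c1 (mem_Scut_of_im (by rw [mul_one]; exact s2))
    (mem_Scut_of_im (by rw [mul_one, Complex.neg_im]; exact neg_ne_zero.2 s1))
  have u2 := tendsto_U c2
    (mem_Scut_of_im (by rw [mul_neg_one, Complex.neg_im]; exact neg_ne_zero.2 s2))
    (mem_Scut_of_im (by rw [mul_neg_one, neg_neg]; exact s1))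
  have u := ((Complex.continuous_im.tendsto _).comp (u1.sub u2)).const_mul (1/2 : ℝ)
  have e3 : -Complex.exp ((2 * π / 3 : ℝ) * Complex.I)
      = (starRingEnd ℂ) (Complex.exp ((π / 3 : ℝ) * Complex.I)) := by
    rw [← neg_neg (Complex.exp ((π / 3 : ℝ) * Complex.I)), neg_exp_eq, map_neg, Complex.conj_conj]
  rw [mul_one, mul_one, mul_neg_one, mul_neg_one, neg_neg, e3, neg_exp_eq,
    Li2_conj (mem_Scut_of_im s1), Li2_conj (mem_Scut_of_im s2)] at u
  refine (u.congr fun n => rfl).congr' EventuallyEq.rfl |>.trans (le_of_eq ?_)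
  congr 1
  have h1 := Li2_im_pi_div_three
  have h2 := Li2_im_two_pi_div_three
  rw [show (3/2 : ℂ) = ((3/2 : ℝ) : ℂ) by push_cast; rfl]
  simp only [Complex.sub_im, Complex.im_ofReal_mul, Complex.conj_im, h1, h2]
  ring

/-- `(2n/(n−1))·Vol(Tₙ) → 5·v_tet` as `n → ∞`. -/
theorem tendsto_vol_ratio :
    Tendsto (fun n : ℕ => (2 * (n : ℝ) / ((n : ℝ) - 1)) * volT n) atTop
      (nhds (5 * vTet)) := by
  have h : Tendsto (fun n : ℕ => 2 * (n : ℝ) / ((n : ℝ) - 1)) atTop (nhds 2) := by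
    have h1 : Tendsto (fun n : ℕ => 2 / (1 - 1 / (n : ℝ))) atTop (nhds (2 / (1 - 0))) :=
      tendsto_const_nhds.div (tendsto_const_nhds.sub (tendsto_const_div_atTop_nhds_zero_nat 1))
        (by norm_num)
    rw [sub_zero, div_one] at h1
    refine h1.congr' ?_
    filter_upwards [eventually_gt_atTop 1] with n hn
    have hn' : (1:ℝ) < n := by exact_mod_cast hn
    have h3 : (n:ℝ) - 1 ≠ 0 := by linarith
    have h4 : (n:ℝ) ≠ 0 := by linarith
    have h5 : 1 - 1 / (n:ℝ) ≠ 0 := by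
      rw [one_sub_div h4]; exact div_ne_zero h3 h4
    field_simp
  have := h.mul tendsto_volT
  rwa [show 2 * (5 / 2 * vTet) = 5 * vTet by ring] at this
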